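/- (Theorem 4: large-scale interconnection of M ensembles.) Let d₁, d₂, d₃ be natural numbers with d = d₁ + d₂ + d₃, and let 𝒜 be a d×d real matrix that is block lower triangular with respect to this decomposition, with diagonal blocks Â, A_f, A_c, where Â is the block diagonal matrix of all agent matrices A_i^q (i = 1,…,N_q, q = 1,…,M), A_f is the block diagonal matrix of the filter matrices A_f^1, …, A_f^M, and A_c is the block diagonal matrix of the controller matrices A_c^1, …, A_c^M, and every one of these matrices A_i^q, A_f^q, A_c^q is Schur. Let β₁, …, β_L ∈ ℝ^d and define W_ℓ(ξ) = 𝒜ξ + β_ℓ. Let p₁, …, p_L : ℝ^d → [0,1] be Dini continuous probability functions with Σ_ℓ p_ℓ(x) = 1 and p_ℓ(x) ≥ δ for some δ > 0 and all x. Then the Markov kernel κ(x) = Σ_ℓ p_ℓ(x)·δ_{W_ℓ(x)} admits a unique invariant Borel probability measure, and this measure is attractive. -/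

import Mathlib

open MeasureTheory Filter Topology

noncomputable section

/-- A real square matrix is Schur if every complex eigenvalue has modulus `< 1`. -/
def IsSchur {ι : Type*} [Fintype ι] [DecidableEq ι] (A : Matrix ι ι ℝ) : Prop :=
  ∀ z ∈ spectrum ℂ (A.map (fun x : ℝ => (x : ℂ))), ‖z‖ < 1

/-- `p` is Dini continuous: `|p x - p y| ≤ φ (dist x y)` for a nondecreasing modulus `φ` with
`φ 0 = 0` and `∫₀¹ φ t / t dt < ∞`. -/
def DiniContinuous {X : Type*} [PseudoMetricSpace X] (p : X → ℝ) : Prop :=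
  ∃ φ : ℝ → ℝ, MonotoneOn φ (Set.Ici 0) ∧ φ 0 = 0 ∧
    IntervalIntegrable (fun t => φ t / t) volume 0 1 ∧
    ∀ x y, |p x - p y| ≤ φ (dist x y)

/-- The Markov kernel `κ x = ∑ ℓ, p ℓ x • δ_{W ℓ x}` of an iterated random function given by
maps `W ℓ` chosen with place-dependent probabilities `p ℓ`. -/
def IFSKernel {X : Type*} [MeasurableSpace X] {L : ℕ}
    (p : Fin L → X → ℝ) (W : Fin L → X → X) (x : X) : Measure X :=
  ∑ ℓ, ENNReal.ofReal (p ℓ x) • Measure.dirac (W ℓ x)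

/-- A measure `μ` is invariant for the kernel `κ` if `μ.bind κ = μ`. -/
def Invariant {X : Type*} [MeasurableSpace X] (κ : X → Measure X) (μ : Measure X) : Prop :=
  μ.bind κ = μ

/-- A measure `μ` is attractive for the kernel `κ` if for every Borel probability measure `ν`,
the iterates `ν, ν.bind κ, (ν.bind κ).bind κ, …` converge weakly to `μ`. -/
def Attractive {X : Type*} [MeasurableSpace X] [TopologicalSpace X]
    (κ : X → Measure X) (μ : Measure X) : Prop :=
  ∀ ν : Measure X, IsProbabilityMeasure ν →
    ∀ f : BoundedContinuousFunction X ℝ,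
      Tendsto (fun k => ∫ x, f x ∂((fun m : Measure X => m.bind κ)^[k] ν))
        atTop (𝓝 (∫ x, f x ∂μ))

/-- The index set of the augmented state in Theorem 4: the states of all agents `i = 1,…,N q`
of all `M` ensembles (agent `i` of ensemble `q` having dimension `n q i`), then the states of
the `M` filters and of the `M` controllers. -/
abbrev IdxMS (M : ℕ) (N : Fin M → ℕ) (n : ∀ q : Fin M, Fin (N q) → ℕ)
    (nf nc : Fin M → ℕ) : Type :=
  ((q : Fin M) × (i : Fin (N q)) × Fin (n q i)) ⊕
    (((q : Fin M) × Fin (nf q)) ⊕ ((q : Fin M) × Fin (nc q)))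

/-- The block an index belongs to, for the three-block decomposition of Theorem 4. -/
def blkMS {M : ℕ} {N : Fin M → ℕ} {n : ∀ q : Fin M, Fin (N q) → ℕ} {nf nc : Fin M → ℕ} :
    IdxMS M N n nf nc → ℕ :=
  Sum.elim (fun _ => 0) (Sum.elim (fun _ => 1) (fun _ => 2))


def opT {X : Type*} {L : ℕ} (p : Fin L → X → ℝ) (W : Fin L → X → X) (g : X → ℝ) : X → ℝ :=
  fun x => ∑ ℓ, p ℓ x * g (W ℓ x)

lemma avg_diff {L : ℕ} [Nonempty (Fin L)] (q q' a b : Fin L → ℝ) (D s : ℝ)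
    (hq : ∀ l, 0 ≤ q l) (hq' : ∀ l, 0 ≤ q' l) (hs : ∑ l, q l = s) (hs' : ∑ l, q' l = s)
    (h : ∀ i j, a i - b j ≤ D) : ∑ l, q l * a l - ∑ l, q' l * b l ≤ s * D := by
  obtain ⟨i0, hi0⟩ := Finite.exists_max a
  obtain ⟨j0, hj0⟩ := Finite.exists_min b
  have h1 : ∑ l, q l * a l ≤ s * a i0 := by
    rw [← hs, Finset.sum_mul]
    exact Finset.sum_le_sum fun l _ => mul_le_mul_of_nonneg_left (hi0 l) (hq l)
  have h2 : s * b j0 ≤ ∑ l, q' l * b l := by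
    rw [← hs', Finset.sum_mul]
    exact Finset.sum_le_sum fun l _ => mul_le_mul_of_nonneg_left (hj0 l) (hq' l)
  have h0 : 0 ≤ s := hs ▸ Finset.sum_nonneg fun l _ => hq l
  have := mul_le_mul_of_nonneg_left (h i0 j0) h0
  linarith

lemma avg_abs {L : ℕ} [Nonempty (Fin L)] (q q' a b : Fin L → ℝ) (D s : ℝ)
    (hq : ∀ l, 0 ≤ q l) (hq' : ∀ l, 0 ≤ q' l) (hs : ∑ l, q l = s) (hs' : ∑ l, q' l = s)
    (h : ∀ i j, |a i - b j| ≤ D) : |∑ l, q l * a l - ∑ l, q' l * b l| ≤ s * D := by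
  rw [abs_le']
  refine ⟨avg_diff q q' a b D s hq hq' hs hs' fun i j => (abs_le'.1 (h i j)).1, ?_⟩
  have := avg_diff q' q b a D s hq' hq hs' hs fun i j => by
    have := (abs_le'.1 (h j i)).2; linarith
  linarith

section step
variable {X : Type*} {L : ℕ} [Nonempty (Fin L)] {p : Fin L → X → ℝ} {W : Fin L → X → X}
  (hp0 : ∀ l x, 0 ≤ p l x) (hp1 : ∀ x, ∑ l, p l x = 1)
include hp0 hp1

lemma step_mono {g : X → ℝ} {x y : X} {D : ℝ} (h : ∀ i j, |g (W i x) - g (W j y)| ≤ D) :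
    |opT p W g x - opT p W g y| ≤ D := by
  have := avg_abs (fun l => p l x) (fun l => p l y) (fun l => g (W l x)) (fun l => g (W l y)) D 1
    (fun l => hp0 l x) (fun l => hp0 l y) (hp1 x) (hp1 y) h
  simpa [opT] using this

lemma step_a {g : X → ℝ} {x y : X} {D ε a : ℝ} (h : ∀ i j, |g (W i y) - g (W j y)| ≤ D)
    (h' : ∀ i, |g (W i x) - g (W i y)| ≤ ε) (ha : ∑ l, |p l x - p l y| ≤ a) (hD : 0 ≤ D) :
    |opT p W g x - opT p W g y| ≤ ε + a * D := by
  obtain ⟨i0⟩ := (inferInstance : Nonempty (Fin L))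
  have e : opT p W g x - opT p W g y = ∑ l, p l x * (g (W l x) - g (W l y))
      + ∑ l, (p l x - p l y) * (g (W l y) - g (W i0 y)) := by
    have : ∑ l, (p l x - p l y) * g (W i0 y) = 0 := by
      rw [← Finset.sum_mul, Finset.sum_sub_distrib, hp1, hp1]; simp
    simp only [mul_sub (p _ x - p _ y), Finset.sum_sub_distrib, this]
    simp only [opT, mul_sub, sub_mul, Finset.sum_sub_distrib]
    ring
  rw [e]
  refine (abs_add_le _ _).trans (add_le_add ?_ ?_)
  · refine (Finset.abs_sum_le_sum_abs _ _).trans ?_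
    calc _ ≤ ∑ l, p l x * ε := Finset.sum_le_sum fun l _ => by
            rw [abs_mul, abs_of_nonneg (hp0 l x)]
            exact mul_le_mul_of_nonneg_left (h' l) (hp0 l x)
      _ = ε := by rw [← Finset.sum_mul, hp1, one_mul]
  · refine (Finset.abs_sum_le_sum_abs _ _).trans ?_
    calc _ ≤ ∑ l, |p l x - p l y| * D := Finset.sum_le_sum fun l _ => by
            rw [abs_mul]
            exact mul_le_mul_of_nonneg_left (h l i0) (abs_nonneg _)
      _ ≤ a * D := by rw [← Finset.sum_mul]; exact mul_le_mul_of_nonneg_right ha hD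

lemma step_b {δ : ℝ} (hδ : 0 < δ) (hpδ : ∀ l x, δ ≤ p l x)
    {g : X → ℝ} {x y : X} {D ε : ℝ} (h : ∀ i j, |g (W i x) - g (W j y)| ≤ D)
    (h' : ∀ i, |g (W i x) - g (W i y)| ≤ ε) :
    |opT p W g x - opT p W g y| ≤ δ * ε + (1 - δ) * D := by
  obtain ⟨i0⟩ := (inferInstance : Nonempty (Fin L))
  have e : ∀ z, opT p W g z = δ * g (W i0 z)
      + ∑ l, (p l z - if l = i0 then δ else 0) * g (W l z) := by
    intro z
    simp [opT, sub_mul, Finset.sum_sub_distrib]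
  have hq : ∀ z l, 0 ≤ p l z - if l = i0 then δ else 0 := by
    intro z l
    split_ifs
    · linarith [hpδ l z]
    · simpa using hp0 l z
  have hs : ∀ z, ∑ l, (p l z - if l = i0 then δ else 0) = 1 - δ := by
    intro z; simp [Finset.sum_sub_distrib, hp1]
  have h1 := avg_abs _ _ (fun l => g (W l x)) (fun l => g (W l y)) D (1 - δ) (hq x) (hq y)
    (hs x) (hs y) h
  have h2 : |δ * g (W i0 x) - δ * g (W i0 y)| ≤ δ * ε := by
    rw [← mul_sub, abs_mul, abs_of_pos hδ]
    exact mul_le_mul_of_nonneg_left (h' i0) hδ.le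
  rw [e x, e y, add_sub_add_comm]
  exact (abs_add_le _ _).trans (add_le_add h2 h1)

end step

section main
variable {X : Type*} {L : ℕ} [Nonempty (Fin L)] {p : Fin L → X → ℝ} {W : Fin L → X → X}
  (hp0 : ∀ l x, 0 ≤ p l x) (hp1 : ∀ x, ∑ l, p l x = 1)
  {K : Set X} (hK : ∀ x ∈ K, ∀ l, W l x ∈ K)
include hp0 hp1 hK

lemma iter_mono {g : X → ℝ} {D : ℝ} (hD : ∀ x ∈ K, ∀ y ∈ K, |g x - g y| ≤ D) (k : ℕ) :
    ∀ x ∈ K, ∀ y ∈ K, |(opT p W)^[k] g x - (opT p W)^[k] g y| ≤ D := by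
  induction k with
  | zero => simpa using hD
  | succ k ih =>
    intro x hx y hy
    rw [Function.iterate_succ_apply']
    exact step_mono hp0 hp1 fun i j => ih _ (hK x hx i) _ (hK y hy j)

variable {S : ℕ → X → X → Prop} (hSK : ∀ j x y, S j x y → x ∈ K ∧ y ∈ K)
  (hSW : ∀ j x y, S j x y → ∀ l, S (j + 1) (W l x) (W l y))
  {a : ℕ → ℝ}
  (haS : ∀ j x y, S j x y → ∑ l, |p l x - p l y| ≤ a j)
include hSK hSW 

lemma iter_a (haS : ∀ j x y, S j x y → ∑ l, |p l x - p l y| ≤ a j) {g : X → ℝ} {D : ℝ}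
    (hD0 : 0 ≤ D) (hD : ∀ x ∈ K, ∀ y ∈ K, |g x - g y| ≤ D) {η : ℝ} (k : ℕ) :
    ∀ i, (∀ x y, S (i + k) x y → |g x - g y| ≤ η) → ∀ x y, S i x y →
      |(opT p W)^[k] g x - (opT p W)^[k] g y| ≤ η + (∑ j ∈ Finset.range k, a (i + j)) * D := by
  induction k with
  | zero => intro i h x y hxy; simpa using h x y hxy
  | succ k ih =>
    intro i h x y hxy
    obtain ⟨hx, hy⟩ := hSK _ _ _ hxy
    rw [Function.iterate_succ_apply', Finset.sum_range_succ', add_mul, ← add_assoc]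
    have hm := iter_mono hp0 hp1 hK hD k
    refine step_a hp0 hp1 (fun i j => hm _ (hK y hy i) _ (hK y hy j)) (fun l => ?_)
      (by simpa using haS i x y hxy) hD0
    have := ih (i + 1) (fun x y h' => h x y (by rwa [show i + (k + 1) = i + 1 + k by ring])) _ _
      (hSW _ _ _ hxy l)
    simpa only [add_assoc, add_comm 1] using this

lemma iter_b {δ : ℝ} (hδ : 0 < δ) (hpδ : ∀ l x, δ ≤ p l x) {g : X → ℝ} {D ε : ℝ}
    (hD : ∀ x ∈ K, ∀ y ∈ K, |g x - g y| ≤ D) (m : ℕ) :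
    ∀ i, (∀ x y, S (i + m) x y → |g x - g y| ≤ ε) → ∀ x y, S i x y →
      |(opT p W)^[m] g x - (opT p W)^[m] g y| ≤ δ ^ m * ε + (1 - δ ^ m) * D := by
  induction m with
  | zero => intro i h x y hxy; simpa using h x y hxy
  | succ k ih =>
    intro i h x y hxy
    obtain ⟨hx, hy⟩ := hSK _ _ _ hxy
    rw [Function.iterate_succ_apply']
    have hm := iter_mono hp0 hp1 hK hD k
    have := step_b (g := (opT p W)^[k] g) hp0 hp1 hδ hpδ
      (fun i j => hm _ (hK x hx i) _ (hK y hy j)) (fun l => ih (i + 1)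
        (fun x y h' => h x y (by rwa [show i + (k + 1) = i + 1 + k by ring])) _ _
        (hSW _ _ _ hxy l))
    refine this.trans (le_of_eq ?_)
    ring

omit hp0 hp1 hK hSK hSW in
lemma tail_small (ha0 : ∀ j, 0 ≤ a j) (ha : Summable a) {c : ℝ} (hc : 0 < c) :
    ∃ m, ∀ k, ∑ j ∈ Finset.range k, a (m + j) ≤ c := by
  have h := tendsto_sum_nat_add a
  obtain ⟨m, hm⟩ := (h.eventually (gt_mem_nhds hc)).exists
  refine ⟨m, fun k => ?_⟩
  refine le_trans ?_ hm.le
  simp only [add_comm m]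
  exact ((summable_nat_add_iff m).2 ha).sum_le_tsum _ (fun j _ => ha0 _)

lemma uc_iter (ha : Summable a) (haS : ∀ j x y, S j x y → ∑ l, |p l x - p l y| ≤ a j)
    {g : X → ℝ} {D : ℝ}
    (hD0 : 0 ≤ D) (hD : ∀ x ∈ K, ∀ y ∈ K, |g x - g y| ≤ D)
    (hg : ∀ η > 0, ∃ J, ∀ j ≥ J, ∀ x y, S j x y → |g x - g y| ≤ η) (k : ℕ) :
    ∀ η > 0, ∃ J, ∀ j ≥ J, ∀ x y, S j x y → 
      |(opT p W)^[k] g x - (opT p W)^[k] g y| ≤ η := by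
  induction k with
  | zero => simpa using hg
  | succ k ih =>
    intro η hη
    obtain ⟨J, hJ⟩ := ih (η / 2) (by positivity)
    have h1 : Tendsto (fun j => a j * D) atTop (𝓝 0) := by
      simpa using ha.tendsto_atTop_zero.mul_const D
    obtain ⟨J', hJ'⟩ := eventually_atTop.1 (h1.eventually (gt_mem_nhds (half_pos hη)))
    refine ⟨max J J', fun j hj x y hxy => ?_⟩
    obtain ⟨hx, hy⟩ := hSK _ _ _ hxy
    rw [Function.iterate_succ_apply']
    have hm := iter_mono hp0 hp1 hK hD k
    have := step_a (g := (opT p W)^[k] g) hp0 hp1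
      (fun i j => hm _ (hK y hy i) _ (hK y hy j))
      (fun l => hJ (j + 1) (by have := le_of_max_le_left hj; omega) _ _ (hSW _ _ _ hxy l))
      (haS j x y hxy) hD0
    linarith [hJ' j (le_of_max_le_right hj)]

lemma osc_tendsto (hS0 : ∀ x ∈ K, ∀ y ∈ K, S 0 x y)
    {δ : ℝ} (hδ : 0 < δ) (hpδ : ∀ l x, δ ≤ p l x)
    (ha0 : ∀ j, 0 ≤ a j) (ha : Summable a)
    (haS : ∀ j x y, S j x y → ∑ l, |p l x - p l y| ≤ a j)
    {g : X → ℝ} {B : ℝ} (hB0 : 0 ≤ B) (hB : ∀ x ∈ K, ∀ y ∈ K, |g x - g y| ≤ B)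
    (hg : ∀ η > 0, ∃ J, ∀ j ≥ J, ∀ x y, S j x y → |g x - g y| ≤ η) :
    ∀ ε > 0, ∃ k0, ∀ k ≥ k0, ∀ x ∈ K, ∀ y ∈ K,
      |(opT p W)^[k] g x - (opT p W)^[k] g y| ≤ ε := by
  set G : ℕ → X → ℝ := fun k => (opT p W)^[k] g with hG
  set D : ℕ → ℝ := fun k => Metric.diam (G k '' K) with hDdef
  have hGB : ∀ k, ∀ x ∈ K, ∀ y ∈ K, |G k x - G k y| ≤ B := iter_mono hp0 hp1 hK hB
  have hle : ∀ k, ∀ x ∈ K, ∀ y ∈ K, |G k x - G k y| ≤ D k := by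
    intro k x hx y hy
    rw [← Real.dist_eq]
    refine Metric.dist_le_diam_of_mem ?_ (Set.mem_image_of_mem _ hx) (Set.mem_image_of_mem _ hy)
    refine Metric.isBounded_iff.2 ⟨B, ?_⟩
    rintro _ ⟨u, hu, rfl⟩ _ ⟨v, hv, rfl⟩
    exact hGB k u hu v hv
  have hD0 : ∀ k, 0 ≤ D k := fun k => Metric.diam_nonneg
  have hdl : ∀ k c, 0 ≤ c → (∀ x ∈ K, ∀ y ∈ K, |G k x - G k y| ≤ c) → D k ≤ c := by
    intro k c hc h
    refine Metric.diam_le_of_forall_dist_le hc ?_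
    rintro _ ⟨u, hu, rfl⟩ _ ⟨v, hv, rfl⟩
    exact h u hu v hv
  have hadd : ∀ i k, G (i + k) = (opT p W)^[k] (G i) := by
    intro i k
    rw [hG]; simp only
    rw [add_comm, Function.iterate_add_apply]
  have hanti : Antitone D := by
    apply antitone_nat_of_succ_le
    intro k
    refine hdl _ _ (hD0 k) ?_
    rw [hadd]
    exact iter_mono hp0 hp1 hK (hle k) 1
  obtain ⟨d, hd⟩ : ∃ d, Tendsto D atTop (𝓝 d) :=
    ⟨_, tendsto_atTop_ciInf hanti ⟨0, by rintro _ ⟨k, rfl⟩; exact hD0 k⟩⟩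
  have hd0 : 0 ≤ d := ge_of_tendsto' hd hD0
  obtain ⟨m, hm⟩ := tail_small ha0 ha (c := 1 / 4) (by norm_num)
  have hδm : 0 < δ ^ m := by positivity
  have hδ1 : δ ≤ 1 ∨ K = ∅ := by
    rcases K.eq_empty_or_nonempty with h | ⟨x, hx⟩
    · exact Or.inr h
    · left
      obtain ⟨i0⟩ := (inferInstance : Nonempty (Fin L))
      rw [← hp1 x]
      exact (hpδ i0 x).trans (Finset.single_le_sum (fun l _ => hp0 l x) (Finset.mem_univ i0))
  rcases hδ1 with hδ1 | hKe
  swap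
  · intro ε hε; exact ⟨0, by simp [hKe]⟩
  have hδm1 : δ ^ m ≤ 1 := pow_le_one₀ hδ.le hδ1
  have key : ∀ i, d ≤ D i / 4 := by
    intro i
    apply le_of_forall_pos_le_add
    intro η hη
    obtain ⟨J, hJ⟩ := uc_iter hp0 hp1 hK hSK hSW ha haS hB0 hB hg i η hη
    have h1 : ∀ᶠ k in atTop, D (i + k + m) ≤ δ ^ m * (η + 1 / 4 * D i)
        + (1 - δ ^ m) * D (i + k) := by
      filter_upwards [eventually_ge_atTop J] with k hk
      refine hdl _ _ ?_ ?_
      · have := hD0 i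
        have := hD0 (i + k)
        have : 0 ≤ 1 - δ ^ m := by linarith
        positivity
      · rw [hadd (i + k) m]
        intro x hx y hy
        refine iter_b hp0 hp1 hK hSK hSW hδ hpδ (hle _) m 0 ?_ x y (hS0 x hx y hy)
        intro u v huv
        rw [zero_add] at huv
        rw [hadd]
        refine (iter_a hp0 hp1 hK hSK hSW haS (hD0 i) (hle i) k m 
          (fun x y h => hJ _ (by omega) x y h) u v huv).trans ?_
        have := mul_le_mul_of_nonneg_right (hm k) (hD0 i)
        linarith
    have t1 : Tendsto (fun k => D (i + k + m)) atTop (𝓝 d) := by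
      have := hd.comp (tendsto_add_atTop_nat (i + m))
      refine this.congr fun k => ?_
      simp only [Function.comp]; congr 1; ring
    have t2 : Tendsto (fun k => D (i + k)) atTop (𝓝 d) := by
      have := hd.comp (tendsto_add_atTop_nat i)
      refine this.congr fun k => ?_
      simp only [Function.comp]; congr 1; ring
    have := le_of_tendsto_of_tendsto t1 ((t2.const_mul (1 - δ ^ m)).const_add
      (δ ^ m * (η + 1 / 4 * D i))) h1
    have h3 : δ ^ m * d ≤ δ ^ m * (η + 1 / 4 * D i) := by linarith
    have := le_of_mul_le_mul_left h3 hδm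
    linarith
  have hdz : d = 0 := by
    have : d ≤ d / 4 := ge_of_tendsto' (hd.div_const 4) key
    linarith
  intro ε hε
  rw [hdz] at hd
  obtain ⟨k0, hk0⟩ := eventually_atTop.1 (hd.eventually (gt_mem_nhds hε))
  exact ⟨k0, fun k hk x hx y hy => (hle k x hx y hy).trans (hk0 k hk).le⟩

end main

def Sch {ι : Type*} [Fintype ι] (A : Matrix ι ι ℝ) : Prop :=
  ∀ (z : ℂ) (v : ι → ℂ), 1 ≤ ‖z‖ → (∀ i, ∑ j, (A i j : ℂ) * v j = z * v i) → ∀ i, v i = 0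

lemma mem_spec_iff {ι : Type*} [Fintype ι] [DecidableEq ι] (A : Matrix ι ι ℝ) (z : ℂ) :
    z ∈ spectrum ℂ (A.map (fun x : ℝ => (x : ℂ))) ↔
      ∃ v : ι → ℂ, v ≠ 0 ∧ ∀ i, ∑ j, (A i j : ℂ) * v j = z * v i := by
  rw [spectrum.mem_iff, Matrix.isUnit_iff_isUnit_det, isUnit_iff_ne_zero, not_not,
    ← Matrix.exists_mulVec_eq_zero_iff]
  refine exists_congr fun v => and_congr Iff.rfl ?_
  rw [funext_iff]
  refine forall_congr' fun i => ?_
  rw [Matrix.sub_mulVec, Matrix.algebraMap_eq_diagonal]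
  simp only [Pi.sub_apply, Matrix.mulVec_diagonal, Pi.zero_apply, sub_eq_zero]
  simp only [Matrix.mulVec, dotProduct, Matrix.map_apply, Pi.algebraMap_apply]
  exact eq_comm

lemma isSchur_iff {ι : Type*} [Fintype ι] [DecidableEq ι] (A : Matrix ι ι ℝ) :
    IsSchur A ↔ Sch A := by
  constructor
  · intro h z v hz hv
    by_contra hne
    have := h z ((mem_spec_iff A z).2 ⟨v, fun h0 => hne (by simp [h0]), hv⟩)
    linarith
  · intro h z hz
    obtain ⟨v, hv0, hv⟩ := (mem_spec_iff A z).1 hz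
    by_contra hne
    exact hv0 (funext (h z v (not_lt.1 hne) hv))

lemma Sch.blockDiagonal' {o : Type*} [Fintype o] [DecidableEq o] {m : o → Type*}
    [∀ k, Fintype (m k)] (A : ∀ k, Matrix (m k) (m k) ℝ) (h : ∀ k, Sch (A k)) :
    Sch (Matrix.blockDiagonal' A) := by
  rintro z v hz hv ⟨k, i⟩
  refine h k z (fun i => v ⟨k, i⟩) hz (fun i => ?_) i
  rw [← hv ⟨k, i⟩, Fintype.sum_sigma, Finset.sum_eq_single k]
  · simp
  · intro b _ hb
    refine Finset.sum_eq_zero fun j _ => ?_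
    rw [Matrix.blockDiagonal'_apply_ne _ _ _ hb.symm]; simp
  · simp

lemma Sch.lower {m n : Type*} [Fintype m] [Fintype n] (A : Matrix (m ⊕ n) (m ⊕ n) ℝ)
    (h0 : ∀ a b, A (Sum.inl a) (Sum.inr b) = 0)
    (h1 : Sch (Matrix.of fun a b => A (Sum.inl a) (Sum.inl b)))
    (h2 : Sch (Matrix.of fun a b => A (Sum.inr a) (Sum.inr b))) : Sch A := by
  intro z v hz hv
  have e1 : ∀ i, v (Sum.inl i) = 0 := h1 z (fun i => v (Sum.inl i)) hz fun i => by
    rw [← hv, Fintype.sum_sum_type]; simp [h0]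
  have e2 : ∀ i, v (Sum.inr i) = 0 := h2 z (fun i => v (Sum.inr i)) hz fun i => by
    rw [← hv, Fintype.sum_sum_type]; simp [e1]
  rintro (i | i)
  exacts [e1 i, e2 i]

lemma summable_pow_of_spec {B : Type*} [NormedRing B] [NormedAlgebra ℂ B] [CompleteSpace B]
    (a : B) (h : ∀ z ∈ spectrum ℂ a, ‖z‖ < 1) : Summable fun n : ℕ => ‖a ^ n‖ := by
  rcases subsingleton_or_nontrivial B with hs | hn
  · have : ∀ n : ℕ, a ^ n = 0 := fun n => Subsingleton.elim _ _
    simp [this]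
  have hr : spectralRadius ℂ a < ((1 : NNReal) : ENNReal) :=
    spectrum.spectralRadius_lt_of_forall_lt a (fun z hz => by exact_mod_cast h z hz)
  obtain ⟨r, hr1, hr2⟩ := ENNReal.lt_iff_exists_nnreal_btwn.1 hr
  have hr2 : r < 1 := by exact_mod_cast hr2
  have hev := (spectrum.pow_nnnorm_pow_one_div_tendsto_nhds_spectralRadius a).eventually
    (gt_mem_nhds hr1)
  refine Summable.of_norm_bounded_eventually_nat (g := fun n => (r : ℝ) ^ n)
    (summable_geometric_of_lt_one r.2 (by exact_mod_cast hr2)) ?_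
  filter_upwards [hev, eventually_gt_atTop 0] with n hn hn0
  rw [norm_norm]
  have h1 : ((‖a ^ n‖₊ : ENNReal) ^ (1 / n : ℝ)) ^ n ≤ (r : ENNReal) ^ n :=
    pow_le_pow_left₀ (by positivity) hn.le n
  rw [← ENNReal.rpow_natCast, ← ENNReal.rpow_mul, one_div_mul_cancel (by positivity),
    ENNReal.rpow_one] at h1
  exact_mod_cast h1

section
attribute [local instance] Matrix.linftyOpNormedRing Matrix.linftyOpNormedAlgebra
  
lemma schur_summable {ι : Type*} [Fintype ι] [DecidableEq ι] (A : Matrix ι ι ℝ) (h : IsSchur A) :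
    ∃ s : ℕ → ℝ, Summable s ∧ ∀ n (x : EuclideanSpace ℝ ι),
      ‖((Matrix.toEuclideanLin A) ^ n) x‖ ≤ s n * ‖x‖ := by
  have hs := summable_pow_of_spec _ h
  have hs' : Summable fun n : ℕ => ‖A ^ n‖ := by
    refine hs.congr fun n => ?_
    have : (A.map (fun x : ℝ => (x : ℂ))) ^ n = (A ^ n).map (fun x : ℝ => (x : ℂ)) :=
      (map_pow (Complex.ofRealHom.mapMatrix) A n).symm
    rw [this]
    simp [Matrix.linfty_opNorm_def]
  let e := EuclideanSpace.equiv ι ℝ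
  let e1 : (ι → ℝ) →L[ℝ] EuclideanSpace ℝ ι := e.symm
  let e2 : EuclideanSpace ℝ ι →L[ℝ] (ι → ℝ) := e
  refine ⟨fun n => ‖e1‖ * ‖A ^ n‖ * ‖e2‖, (hs'.mul_left _).mul_right _, fun n x => ?_⟩
  have h1 : ((Matrix.toEuclideanLin A) ^ n) x = e1 ((A ^ n).mulVec (e2 x)) := by
    have : (Matrix.toEuclideanLin A) ^ n = Matrix.toEuclideanLin (A ^ n) :=
      (map_pow (Matrix.toLpLinAlgEquiv (R := ℝ) (n := ι) 2) A n).symm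
    rw [this]; rfl
  rw [h1]
  calc _ ≤ ‖e1‖ * ‖(A ^ n).mulVec (e2 x)‖ := e1.le_opNorm _
    _ ≤ ‖e1‖ * (‖A ^ n‖ * ‖e2 x‖) := by
      gcongr; exact Matrix.linfty_opNorm_mulVec _ _
    _ ≤ ‖e1‖ * (‖A ^ n‖ * (‖e2‖ * ‖x‖)) := by
      gcongr; exact e2.le_opNorm _
    _ = _ := by ring
end

/-- adapted norm -/
lemma exists_adapted {E : Type*} [NormedAddCommGroup E] [NormedSpace ℝ E] (A : E →ₗ[ℝ] E)
    (s : ℕ → ℝ) (hs : Summable s) (h : ∀ n x, ‖(A ^ n) x‖ ≤ s n * ‖x‖) :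
    ∃ (N : E → ℝ) (C ρ : ℝ), 0 < ρ ∧ ρ < 1 ∧ (∀ x, ‖x‖ ≤ N x) ∧ (∀ x, N x ≤ C * ‖x‖) ∧
      (∀ x y, N (x + y) ≤ N x + N y) ∧ (∀ x, N (-x) = N x) ∧ (∀ x, N (A x) ≤ ρ * N x) := by
  have hsum : ∀ x, Summable fun n => ‖(A ^ n) x‖ := fun x =>
    Summable.of_nonneg_of_le (fun _ => norm_nonneg _) (fun n => h n x) (hs.mul_right _)
  set C := max (∑' n, s n) 2 with hC
  have hC2 : 2 ≤ C := le_max_right _ _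
  have hb : ∀ x, ∑' n, ‖(A ^ n) x‖ ≤ C * ‖x‖ := fun x => by
    refine ((hsum x).tsum_le_tsum (fun n => h n x) (hs.mul_right _)).trans ?_
    rw [tsum_mul_right]
    exact mul_le_mul_of_nonneg_right (le_max_left _ _) (norm_nonneg _)
  have hi : C⁻¹ ≤ 2⁻¹ := inv_anti₀ (by norm_num) hC2
  have hi0 : 0 < C⁻¹ := by positivity
  refine ⟨fun x => ∑' n, ‖(A ^ n) x‖, C, 1 - C⁻¹, by linarith, by linarith,
    ?_, hb, ?_, ?_, ?_⟩
  · intro x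
    simpa using (hsum x).le_tsum 0 (fun _ _ => norm_nonneg _)
  · intro x y
    rw [← (hsum x).tsum_add (hsum y)]
    refine (hsum _).tsum_le_tsum (fun n => ?_) ((hsum x).add (hsum y))
    rw [map_add]; exact norm_add_le _ _
  · intro x; simp
  · intro x
    have e : ∑' n, ‖(A ^ n) x‖ = ‖x‖ + ∑' n, ‖(A ^ n) (A x)‖ := by
      rw [(hsum x).tsum_eq_zero_add]
      simp [pow_succ]
    have := hb x
    have h3 : C⁻¹ * ∑' n, ‖(A ^ n) x‖ ≤ ‖x‖ := by
      rw [inv_mul_le_iff₀ (by positivity)]; exact this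
    have : (1 - C⁻¹) * ∑' n, ‖(A ^ n) x‖ = ∑' n, ‖(A ^ n) x‖ - C⁻¹ * ∑' n, ‖(A ^ n) x‖ := by ring
    linarith

/-- Dini summability -/
lemma dini_summable {φ : ℝ → ℝ} (hm : MonotoneOn φ (Set.Ici 0)) (h0 : φ 0 = 0)
    (hi : IntervalIntegrable (fun t => φ t / t) volume 0 1) {ρ t : ℝ} (hρ0 : 0 < ρ) (hρ1 : ρ < 1)
    (ht : 0 < t) : Summable fun j : ℕ => φ (ρ ^ j * t) := by
  have hnn : ∀ x, 0 ≤ x → 0 ≤ φ x := fun x hx => h0 ▸ hm (Set.mem_Ici.2 le_rfl) hx hx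
  obtain ⟨j0, hj0⟩ : ∃ j0 : ℕ, ρ ^ j0 * t < 1 := by
    have := (tendsto_pow_atTop_nhds_zero_of_lt_one hρ0.le hρ1).mul_const t
    rw [zero_mul] at this
    exact (this.eventually (gt_mem_nhds one_pos)).exists
  rw [← summable_nat_add_iff (j0 + 1)]
  set b : ℕ → ℝ := fun j => ρ ^ (j + j0) * t with hb
  have hbpos : ∀ j, 0 < b j := fun j => by positivity
  have hbsucc : ∀ j, b (j + 1) = ρ * b j := fun j => by simp only [hb]; ring
  have hb1 : ∀ j, b j ≤ 1 := fun j => by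
    refine le_trans ?_ hj0.le
    simp only [hb]
    refine mul_le_mul_of_nonneg_right ?_ ht.le
    exact pow_le_pow_of_le_one hρ0.le hρ1.le (by omega)
  have hint : ∀ u v, 0 ≤ u → u ≤ v → v ≤ 1 → IntervalIntegrable (fun t => φ t / t) volume u v := by
    intro u v hu huv hv
    refine hi.mono_set ?_
    rw [Set.uIcc_of_le huv, Set.uIcc_of_le zero_le_one]
    exact Set.Icc_subset_Icc hu hv
  have hblt : ∀ j, b (j + 1) ≤ b j := fun j => by
    rw [hbsucc]; have := hbpos j; nlinarith
  have hstep : ∀ j, φ (b (j + 1)) * (1 - ρ) ≤ ∫ x in (b (j + 1))..(b j), φ x / x := by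
    intro j
    have hc : ∫ x in (b (j + 1))..(b j), φ (b (j + 1)) / b j = φ (b (j + 1)) * (1 - ρ) := by
      rw [intervalIntegral.integral_const, hbsucc, smul_eq_mul]
      have := (hbpos j).ne'
      field_simp
    rw [← hc]
    refine intervalIntegral.integral_mono_on (hblt j) (by simp)
      (hint _ _ (hbpos _).le (hblt j) (hb1 j)) fun x hx => ?_
    have hx0 : 0 < x := (hbpos _).trans_le hx.1
    exact div_le_div₀ (hnn x hx0.le) (hm (hbpos _).le hx0.le hx.1) hx0 hx.2
  have hsum : ∀ n, ∑ j ∈ Finset.range n, φ (b (j + 1)) * (1 - ρ) ≤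
      ∫ x in (b n)..(b 0), φ x / x := by
    intro n
    induction n with
    | zero => simp
    | succ n ih =>
      have hbn0 : b n ≤ b 0 := (antitone_nat_of_succ_le hblt) (Nat.zero_le n)
      rw [Finset.sum_range_succ, ← intervalIntegral.integral_add_adjacent_intervals
        (hint _ _ (hbpos _).le (hblt n) (hb1 n)) (hint _ _ (hbpos _).le hbn0 (hb1 0))]
      linarith [hstep n]
  have hub : ∀ n, ∫ x in (b n)..(b 0), φ x / x ≤ ∫ x in (0:ℝ)..1, φ x / x := by
    intro n
    have hbn0 : b n ≤ b 0 := (antitone_nat_of_succ_le hblt) (Nat.zero_le n)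
    refine intervalIntegral.integral_mono_interval (hbpos n).le hbn0 (hb1 0) ?_ hi
    filter_upwards [ae_restrict_mem measurableSet_Ioc] with x hx
    exact div_nonneg (hnn x hx.1.le) hx.1.le
  have h1 : Summable fun j => φ (b (j + 1)) * (1 - ρ) :=
    summable_of_sum_range_le (fun j => mul_nonneg (hnn _ (hbpos _).le) (by linarith))
      (fun n => (hsum n).trans (hub n))
  have h2 := h1.mul_right ((1 - ρ)⁻¹)
  refine h2.congr fun j => ?_
  have : 1 - ρ ≠ 0 := by linarith
  rw [mul_assoc, mul_inv_cancel₀ this, mul_one]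
  congr 1
  simp only [hb]; congr 2; ring

section meas
variable {X : Type*} {L : ℕ} {p : Fin L → X → ℝ} {W : Fin L → X → X}

lemma ifs_measurable [MeasurableSpace X] (hp : ∀ l, Measurable (p l)) (hW : ∀ l, Measurable (W l)) :
    Measurable (IFSKernel p W) := by
  refine Measure.measurable_of_measurable_coe _ fun s hs => ?_
  simp only [IFSKernel, Measure.coe_finsetSum, Finset.sum_apply, Measure.smul_apply, smul_eq_mul]
  refine Finset.measurable_sum _ fun l _ => ?_
  refine (hp l).ennreal_ofReal.mul ?_
  simp only [Measure.dirac_apply' _ hs]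
  exact (measurable_one.indicator hs).comp (hW l)

lemma ifs_prob [MeasurableSpace X] (hp0 : ∀ l x, 0 ≤ p l x) (hp1 : ∀ x, ∑ l, p l x = 1) (x : X) :
    IsProbabilityMeasure (IFSKernel p W x) := by
  constructor
  simp only [IFSKernel, Measure.coe_finsetSum, Finset.sum_apply, Measure.smul_apply, smul_eq_mul,
    measure_univ, mul_one]
  rw [← ENNReal.ofReal_sum_of_nonneg (fun l _ => hp0 l x), hp1]; simp

variable [TopologicalSpace X] 

lemma opT_cont (hp : ∀ l, Continuous (p l)) (hW : ∀ l, Continuous (W l)) {g : X → ℝ}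
    (hg : Continuous g) (k : ℕ) : Continuous ((opT p W)^[k] g) := by
  induction k with
  | zero => simpa
  | succ k ih =>
    rw [Function.iterate_succ_apply']
    exact continuous_finsetSum _ fun l _ => (hp l).mul (ih.comp (hW l))

omit [TopologicalSpace X] in
lemma opT_near (hp0 : ∀ l x, 0 ≤ p l x) (hp1 : ∀ x, ∑ l, p l x = 1) {K : Set X}
    (hK : ∀ x ∈ K, ∀ l, W l x ∈ K) {g : X → ℝ} {c B : ℝ}
    (hg : ∀ x ∈ K, |g x - c| ≤ B) (k : ℕ) : ∀ x ∈ K, |(opT p W)^[k] g x - c| ≤ B := by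
  induction k with
  | zero => simpa using hg
  | succ k ih =>
    intro x hx
    rw [Function.iterate_succ_apply']
    have e : opT p W ((opT p W)^[k] g) x - c = ∑ l, p l x * ((opT p W)^[k] g (W l x) - c) := by
      simp only [mul_sub, Finset.sum_sub_distrib, ← Finset.sum_mul, hp1, one_mul]; rfl
    rw [e]
    refine (Finset.abs_sum_le_sum_abs _ _).trans ?_
    calc _ ≤ ∑ l, p l x * B := Finset.sum_le_sum fun l _ => by
            rw [abs_mul, abs_of_nonneg (hp0 l x)]
            exact mul_le_mul_of_nonneg_left (ih _ (hK x hx l)) (hp0 l x)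
      _ = B := by rw [← Finset.sum_mul, hp1, one_mul]

omit [TopologicalSpace X] in
lemma opT_bdd (hp0 : ∀ l x, 0 ≤ p l x) (hp1 : ∀ x, ∑ l, p l x = 1) {g : X → ℝ} {B : ℝ}
    (hg : ∀ x, |g x| ≤ B) (k : ℕ) (x : X) : |(opT p W)^[k] g x| ≤ B := by
  have := opT_near (W := W) hp0 hp1 (K := Set.univ) (fun _ _ _ => Set.mem_univ _) (c := 0) (B := B)
    (g := g) (by simpa using hg) k x (Set.mem_univ _)
  simpa using this

variable [MeasurableSpace X] [BorelSpace X]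

lemma bind_prob (hp0 : ∀ l x, 0 ≤ p l x) (hp1 : ∀ x, ∑ l, p l x = 1)
    (hp : ∀ l, Continuous (p l)) (hW : ∀ l, Continuous (W l))
    (ν : Measure X) [IsProbabilityMeasure ν] : IsProbabilityMeasure (ν.bind (IFSKernel p W)) := by
  constructor
  have hm := ifs_measurable (fun l => (hp l).measurable) (fun l => (hW l).measurable)
  rw [Measure.bind_apply MeasurableSet.univ hm.aemeasurable]
  have : ∀ x, IFSKernel p W x Set.univ = 1 := fun x => (ifs_prob hp0 hp1 x).measure_univ
  simp [this]

lemma int_bind (hp0 : ∀ l x, 0 ≤ p l x) (hp1 : ∀ x, ∑ l, p l x = 1)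
    (hp : ∀ l, Continuous (p l)) (hW : ∀ l, Continuous (W l))
    (ν : Measure X) [IsProbabilityMeasure ν] {g : X → ℝ} {B : ℝ} (hg : Continuous g)
    (hB : ∀ x, |g x| ≤ B) : ∫ x, g x ∂(ν.bind (IFSKernel p W)) = ∫ x, opT p W g x ∂ν := by
  have hm := ifs_measurable (fun l => (hp l).measurable) (fun l => (hW l).measurable)
  have := bind_prob hp0 hp1 hp hW ν
  let κ : ProbabilityTheory.Kernel X X := ⟨IFSKernel p W, hm⟩
  have hint : Integrable g (ν.bind κ) :=
by
    have : IsProbabilityMeasure (ν.bind κ) := bind_prob hp0 hp1 hp hW ν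
    exact Integrable.of_bound hg.measurable.aestronglyMeasurable B (Eventually.of_forall hB)
  change ∫ x, g x ∂(ν.bind κ) = _
  rw [Measure.comp_eq_comp_const_apply] at hint ⊢
  rw [ProbabilityTheory.Kernel.integral_comp hint]
  simp only [ProbabilityTheory.Kernel.const_apply]
  refine integral_congr_ae (Eventually.of_forall fun x => ?_)
  change ∫ y, g y ∂(IFSKernel p W x) = _
  simp only [IFSKernel, opT]
  have hmg := hg.stronglyMeasurable
  rw [integral_finsetSum_measure]
  · refine Finset.sum_congr rfl fun l _ => ?_
    rw [integral_smul_measure, integral_dirac' _ _ hmg, ENNReal.toReal_ofReal (hp0 l x),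
      smul_eq_mul]
  · intro l _
    refine Integrable.smul_measure ?_ (by simp)
    exact Integrable.of_bound hmg.aestronglyMeasurable B (Eventually.of_forall hB)

lemma iter_prob (hp0 : ∀ l x, 0 ≤ p l x) (hp1 : ∀ x, ∑ l, p l x = 1)
    (hp : ∀ l, Continuous (p l)) (hW : ∀ l, Continuous (W l))
    (ν : Measure X) [hν : IsProbabilityMeasure ν] (k : ℕ) :
    IsProbabilityMeasure ((fun m : Measure X => m.bind (IFSKernel p W))^[k] ν) := by
  induction k with
  | zero => simpa
  | succ k ih =>
    rw [Function.iterate_succ_apply']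
    exact bind_prob hp0 hp1 hp hW _

lemma int_iter (hp0 : ∀ l x, 0 ≤ p l x) (hp1 : ∀ x, ∑ l, p l x = 1)
    (hp : ∀ l, Continuous (p l)) (hW : ∀ l, Continuous (W l))
    {g : X → ℝ} {B : ℝ} (hg : Continuous g)
    (hB : ∀ x, |g x| ≤ B) (k : ℕ) : ∀ (ν : Measure X) [IsProbabilityMeasure ν],
    ∫ x, g x ∂((fun m : Measure X => m.bind (IFSKernel p W))^[k] ν)
      = ∫ x, (opT p W)^[k] g x ∂ν := by
  induction k with
  | zero => intro ν _; rfl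
  | succ k ih =>
    intro ν _
    have := bind_prob hp0 hp1 hp hW ν
    rw [Function.iterate_succ_apply, ih, int_bind hp0 hp1 hp hW ν (opT_cont hp hW hg k)
      (opT_bdd hp0 hp1 hB k), Function.iterate_succ_apply']

lemma iter_supp (hp : ∀ l, Continuous (p l)) (hW : ∀ l, Continuous (W l))
    {K : Set X} (hKm : MeasurableSet K)
    (hK : ∀ x ∈ K, ∀ l, W l x ∈ K) (ν : Measure X) (hν : ν Kᶜ = 0) (k : ℕ) :
    ((fun m : Measure X => m.bind (IFSKernel p W))^[k] ν) Kᶜ = 0 := by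
  have hm := ifs_measurable (fun l => (hp l).measurable) (fun l => (hW l).measurable)
  induction k with
  | zero => simpa
  | succ k ih =>
    rw [Function.iterate_succ_apply']
    rw [Measure.bind_apply hKm.compl hm.aemeasurable]
    have hmm : Measurable fun a => IFSKernel p W a Kᶜ :=
      (Measure.measurable_coe hKm.compl).comp hm
    rw [lintegral_eq_zero_iff hmm]
    have : ∀ᵐ x ∂((fun m : Measure X => m.bind (IFSKernel p W))^[k] ν), x ∈ K := ih
    filter_upwards [this] with x hx
    simp only [IFSKernel, Measure.coe_finsetSum, Finset.sum_apply, Measure.smul_apply, smul_eq_mul,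
      Measure.dirac_apply' _ hKm.compl]
    simp [hK x hx]

end meas

/-- abstract conclusion from pointwise convergence to constants -/
lemma abstract_concl {X : Type*} {L : ℕ} {p : Fin L → X → ℝ} {W : Fin L → X → X}
    [MetricSpace X] [MeasurableSpace X] [BorelSpace X]
    (hp0 : ∀ l x, 0 ≤ p l x) (hp1 : ∀ x, ∑ l, p l x = 1)
    (hp : ∀ l, Continuous (p l)) (hW : ∀ l, Continuous (W l))
    {K : Set X} (hKc : IsCompact K) (hK : ∀ x ∈ K, ∀ l, W l x ∈ K) {x0 : X} (hx0 : x0 ∈ K)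
    (hconv : ∀ f : BoundedContinuousFunction X ℝ, ∃ c, ∀ x,
      Tendsto (fun k => (opT p W)^[k] f x) atTop (𝓝 c)) :
    ∃ μstar : Measure X,
      (IsProbabilityMeasure μstar ∧ Invariant (IFSKernel p W) μstar) ∧
      (∀ μ : Measure X, IsProbabilityMeasure μ → Invariant (IFSKernel p W) μ → μ = μstar) ∧
      Attractive (IFSKernel p W) μstar := by
  choose c hc using hconv
  have hfB : ∀ (f : BoundedContinuousFunction X ℝ) x, |f x| ≤ ‖f‖ := fun f x => f.norm_coe_le_norm x
  -- convergence of integrals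
  have hlim : ∀ (ν : Measure X) [IsProbabilityMeasure ν] (f : BoundedContinuousFunction X ℝ),
      Tendsto (fun k => ∫ x, f x ∂((fun m : Measure X => m.bind (IFSKernel p W))^[k] ν))
        atTop (𝓝 (c f)) := by
    intro ν _ f
    have e : ∀ k, ∫ x, f x ∂((fun m : Measure X => m.bind (IFSKernel p W))^[k] ν)
        = ∫ x, (opT p W)^[k] f x ∂ν :=
      fun k => int_iter hp0 hp1 hp hW f.continuous (hfB f) k ν
    simp only [e]
    have := tendsto_integral_of_dominated_convergence (μ := ν)
      (F := fun k x => (opT p W)^[k] f x) (f := fun _ => c f) (fun _ => ‖f‖)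
      (fun k => (opT_cont hp hW f.continuous k).measurable.aestronglyMeasurable)
      (integrable_const _) (fun k => Eventually.of_forall (opT_bdd hp0 hp1 (hfB f) k))
      (Eventually.of_forall (hc f))
    simpa using this
  -- the sequence of laws from x0
  let νs : ℕ → ProbabilityMeasure X := fun k =>
    ⟨(fun m : Measure X => m.bind (IFSKernel p W))^[k] (Measure.dirac x0),
      iter_prob hp0 hp1 hp hW _ k⟩
  have htight : IsTightMeasureSet {((μ : ProbabilityMeasure X) : Measure X) | μ ∈ Set.range νs} := by
    rw [isTightMeasureSet_iff_exists_isCompact_measure_compl_le]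
    intro ε hε
    refine ⟨K, hKc, ?_⟩
    rintro _ ⟨_, ⟨k, rfl⟩, rfl⟩
    have : (νs k : Measure X) Kᶜ = 0 := iter_supp hp hW hKc.measurableSet hK _
      (by rw [Measure.dirac_apply' _ hKc.measurableSet.compl]; simp [hx0]) k
    rw [this]; exact bot_le
  have hcomp := isCompact_closure_of_isTightMeasureSet htight
  obtain ⟨μ, -, hμ⟩ := hcomp (f := map νs atTop)
    (by rw [le_principal_iff, mem_map]; exact univ_mem' fun k => subset_closure ⟨k, rfl⟩)
  have hμc : ∀ f : BoundedContinuousFunction X ℝ, ∫ x, f x ∂(μ : Measure X) = c f := by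
    intro f
    have hcont : Continuous fun m : ProbabilityMeasure X => ∫ x, f x ∂(m : Measure X) :=
      ProbabilityMeasure.continuous_integral_boundedContinuousFunction f
    have h1 : MapClusterPt (∫ x, f x ∂(μ : Measure X)) atTop
        ((fun m : ProbabilityMeasure X => ∫ x, f x ∂(m : Measure X)) ∘ νs) :=
      MapClusterPt.continuousAt_comp hcont.continuousAt hμ
    have h2 : Tendsto ((fun m : ProbabilityMeasure X => ∫ x, f x ∂(m : Measure X)) ∘ νs) atTop
        (𝓝 (c f)) := hlim (Measure.dirac x0) f
    have h3 : ClusterPt (∫ x, f x ∂(μ : Measure X)) (𝓝 (c f)) := ClusterPt.mono h1 h2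
    exact eq_of_nhds_neBot h3
  refine ⟨μ, ⟨inferInstance, ?_⟩, ?_, ?_⟩
  · have := bind_prob hp0 hp1 hp hW (μ : Measure X)
    refine ext_of_forall_integral_eq_of_IsFiniteMeasure fun f => ?_
    rw [int_bind hp0 hp1 hp hW _ f.continuous (hfB f)]
    let f' : BoundedContinuousFunction X ℝ := BoundedContinuousFunction.ofNormedAddCommGroup
      (opT p W f) (opT_cont hp hW f.continuous 1) ‖f‖ (opT_bdd hp0 hp1 (hfB f) 1)
    have h1 : ∫ x, opT p W f x ∂(μ : Measure X) = c f' := hμc f'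
    rw [h1, hμc f]
    refine tendsto_nhds_unique (hc f' x0) ?_
    exact (hc f x0).comp (tendsto_add_atTop_nat 1)
  · intro ν hν hinv
    refine ext_of_forall_integral_eq_of_IsFiniteMeasure fun f => ?_
    rw [hμc f]
    refine tendsto_nhds_unique ?_ (hlim ν f)
    have : ∀ k, (fun m : Measure X => m.bind (IFSKernel p W))^[k] ν = ν :=
      fun k => Function.iterate_fixed (f := fun m : Measure X => m.bind (IFSKernel p W)) hinv k
    simp only [this]
    exact tendsto_const_nhds
  · intro ν hν f
    rw [hμc f]
    exact hlim ν f

lemma dini_continuous {X : Type*} [PseudoMetricSpace X] {q : X → ℝ} (h : DiniContinuous q) :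
    Continuous q := by
  obtain ⟨φ, hm, h0, hi, hq⟩ := h
  have hs := dini_summable hm h0 hi (ρ := 1 / 2) (t := 1) (by norm_num) (by norm_num) one_pos
  rw [Metric.continuous_iff]
  intro b ε hε
  obtain ⟨j, hj⟩ := (hs.tendsto_atTop_zero.eventually (gt_mem_nhds hε)).exists
  refine ⟨(1 / 2) ^ j * 1, by positivity, fun a hab => ?_⟩
  rw [Real.dist_eq]
  exact ((hq a b).trans (hm dist_nonneg (dist_nonneg.trans hab.le) hab.le)).trans_lt hj

lemma affine_main {E : Type*} [NormedAddCommGroup E] [NormedSpace ℝ E] [ProperSpace E]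
    [MeasurableSpace E] [BorelSpace E] (A : E →ₗ[ℝ] E)
    {N : E → ℝ} {C ρ : ℝ} (hρ0 : 0 < ρ) (hρ1 : ρ < 1) (hN1 : ∀ x, ‖x‖ ≤ N x)
    (hN2 : ∀ x, N x ≤ C * ‖x‖) (hNadd : ∀ x y, N (x + y) ≤ N x + N y) (hNneg : ∀ x, N (-x) = N x)
    (hNA : ∀ x, N (A x) ≤ ρ * N x) {L : ℕ} (β : Fin L → E) (W : Fin L → E → E)
    (hW : ∀ l x, W l x = A x + β l) (p : Fin L → E → ℝ)
    (hp0 : ∀ l x, 0 ≤ p l x) (hp1 : ∀ x, ∑ l, p l x = 1) (hpD : ∀ l, DiniContinuous (p l))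
    (δ : ℝ) (hδ : 0 < δ) (hpδ : ∀ l x, δ ≤ p l x) :
    ∃ μstar : Measure E,
      (IsProbabilityMeasure μstar ∧ Invariant (IFSKernel p W) μstar) ∧
      (∀ μ : Measure E, IsProbabilityMeasure μ → Invariant (IFSKernel p W) μ → μ = μstar) ∧
      Attractive (IFSKernel p W) μstar := by
  have : Nonempty (Fin L) := by
    by_contra h
    rw [not_nonempty_iff] at h
    have := hp1 0
    simp at this
  have hN0 : ∀ x, 0 ≤ N x := fun x => (norm_nonneg x).trans (hN1 x)
  have hpc : ∀ l, Continuous (p l) := fun l => dini_continuous (hpD l)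
  have hsub : ∀ x y, N x - N y ≤ C * ‖x - y‖ := fun x y => by
    have := hNadd (x - y) y
    rw [sub_add_cancel] at this
    linarith [hN2 (x - y)]
  have hNc : Continuous N := by
    refine (LipschitzWith.of_dist_le_mul (K := C.toNNReal) fun x y => ?_).continuous
    have hC : C * ‖x - y‖ ≤ (C.toNNReal : ℝ) * ‖x - y‖ :=
      mul_le_mul_of_nonneg_right (Real.le_coe_toNNReal C) (norm_nonneg _)
    rw [Real.dist_eq, dist_eq_norm, abs_le']
    refine ⟨(hsub x y).trans hC, ?_⟩
    have := hsub y x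
    rw [norm_sub_rev] at this
    linarith
  have hAc : Continuous A := by
    refine A.mkContinuous (ρ * C) (fun x => ?_) |>.continuous
    calc ‖A x‖ ≤ N (A x) := hN1 _
      _ ≤ ρ * N x := hNA x
      _ ≤ ρ * (C * ‖x‖) := mul_le_mul_of_nonneg_left (hN2 x) hρ0.le
      _ = _ := by ring
  have hWc : ∀ l, Continuous (W l) := fun l => by
    have : W l = fun x => A x + β l := funext (hW l)
    rw [this]; exact hAc.add continuous_const
  obtain ⟨b, hb⟩ : ∃ b, ∀ l, N (β l) ≤ b := by
    obtain ⟨i, hi⟩ := Finite.exists_max fun l => N (β l)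
    exact ⟨_, hi⟩
  have hb0 : 0 ≤ b := (hN0 _).trans (hb (Classical.arbitrary _))
  set R0 := b / (1 - ρ) with hR0
  have hR00 : 0 ≤ R0 := div_nonneg hb0 (by linarith)
  have hKinv : ∀ R, R0 ≤ R → ∀ x ∈ {x | N x ≤ R}, ∀ l, W l x ∈ {x | N x ≤ R} := by
    intro R hR x hx l
    simp only [Set.mem_ofPred_eq] at hx ⊢
    rw [hW]
    have h1 := hNadd (A x) (β l)
    have h2 := hNA x
    have h3 := mul_le_mul_of_nonneg_left hx hρ0.le
    have h4 : b ≤ R * (1 - ρ) := by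
      rw [hR0, div_le_iff₀ (by linarith)] at hR; exact hR
    linarith [hb l]
  have hKc : ∀ R, IsCompact {x | N x ≤ R} := by
    intro R
    refine Metric.isCompact_of_isClosed_isBounded (isClosed_le hNc continuous_const) ?_
    refine Metric.isBounded_closedBall (x := (0 : E)) (r := R) |>.subset fun x hx => ?_
    simpa using (hN1 x).trans hx
  -- oscillation
  have hosc : ∀ R, R0 ≤ R → ∀ f : BoundedContinuousFunction E ℝ, ∀ ε > 0, ∃ k0, ∀ k ≥ k0,
      ∀ x ∈ {x | N x ≤ R}, ∀ y ∈ {x | N x ≤ R},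
        |(opT p W)^[k] f x - (opT p W)^[k] f y| ≤ ε := by
    intro R hR f
    choose φ hφm hφ0 hφi hφ using hpD
    set t : ℝ := 2 * R + 1 with ht
    have ht0 : 0 < t := by linarith
    have hφnn : ∀ l x, 0 ≤ x → 0 ≤ φ l x := fun l x hx =>
      hφ0 l ▸ hφm l (Set.mem_Ici.2 le_rfl) hx hx
    refine osc_tendsto (a := fun j => ∑ l, φ l (ρ ^ j * t))
      (S := fun j x y => (N x ≤ R ∧ N y ≤ R) ∧ N (x - y) ≤ ρ ^ j * t)
      hp0 hp1 (hKinv R hR) (fun j x y h => h.1) ?_ ?_ hδ hpδ ?_ ?_ ?_ (B := 2 * ‖f‖)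
      (by positivity) ?_ ?_
    · rintro j x y ⟨⟨hx, hy⟩, hxy⟩ l
      refine ⟨⟨hKinv R hR x hx l, hKinv R hR y hy l⟩, ?_⟩
      have : W l x - W l y = A (x - y) := by rw [hW, hW, map_sub]; abel
      rw [this, pow_succ']
      calc _ ≤ ρ * N (x - y) := hNA _
        _ ≤ ρ * (ρ ^ j * t) := mul_le_mul_of_nonneg_left hxy hρ0.le
        _ = _ := by ring
    · intro x hx y hy
      refine ⟨⟨hx, hy⟩, ?_⟩
      have := hNadd x (-y)
      rw [hNneg, ← sub_eq_add_neg] at this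
      simp only [Set.mem_ofPred_eq] at hx hy
      simp only [pow_zero, one_mul]
      linarith
    · intro j
      exact Finset.sum_nonneg fun l _ => hφnn l _ (by positivity)
    · exact summable_sum fun l _ => dini_summable (hφm l) (hφ0 l) (hφi l) hρ0 hρ1 ht0
    · rintro j x y ⟨-, hxy⟩
      refine Finset.sum_le_sum fun l _ => (hφ l x y).trans ?_
      refine hφm l dist_nonneg (Set.mem_Ici.2 (by positivity)) ?_
      rw [dist_eq_norm]
      exact (hN1 _).trans hxy
    · intro x _ y _
      have := f.dist_le_two_norm x y
      rwa [Real.dist_eq] at this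
    · intro η hη
      have huc := (hKc R).uniformContinuousOn_of_continuous f.continuous.continuousOn
      rw [Metric.uniformContinuousOn_iff] at huc
      obtain ⟨d, hd, hd'⟩ := huc η hη
      have h1 : Tendsto (fun j : ℕ => ρ ^ j * t) atTop (𝓝 0) := by
        simpa using (tendsto_pow_atTop_nhds_zero_of_lt_one hρ0.le hρ1).mul_const t
      obtain ⟨J, hJ⟩ := eventually_atTop.1 (h1.eventually (gt_mem_nhds hd))
      refine ⟨J, fun j hj x y ⟨⟨hx, hy⟩, hxy⟩ => ?_⟩
      rw [← Real.dist_eq]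
      refine (hd' x hx y hy ?_).le
      rw [dist_eq_norm]
      exact ((hN1 _).trans hxy).trans_lt (hJ j hj)
  have hNz : N 0 ≤ R0 := by
    have := hN2 0
    rw [norm_zero, mul_zero] at this
    linarith
  refine abstract_concl hp0 hp1 hpc hWc (hKc R0) (hKinv R0 le_rfl) (x0 := 0) hNz ?_
  intro f
  have hcauchy : CauchySeq fun k => (opT p W)^[k] f 0 := by
    rw [Metric.cauchySeq_iff']
    intro ε hε
    obtain ⟨k0, hk0⟩ := hosc R0 le_rfl f (ε / 2) (half_pos hε)
    refine ⟨k0, fun n hn => ?_⟩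
    obtain ⟨m, rfl⟩ := Nat.exists_eq_add_of_le hn
    rw [Real.dist_eq, add_comm k0 m, Function.iterate_add_apply]
    have := opT_near hp0 hp1 (hKinv R0 le_rfl) (g := (opT p W)^[k0] f)
      (c := (opT p W)^[k0] f 0) (B := ε / 2) (fun x hx => hk0 k0 le_rfl x hx 0 hNz) m 0 hNz
    linarith
  obtain ⟨c, hc⟩ := cauchySeq_tendsto_of_complete hcauchy
  refine ⟨c, fun x => ?_⟩
  have hd : Tendsto (fun k => (opT p W)^[k] f x - (opT p W)^[k] f 0) atTop (𝓝 0) := by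
    rw [Metric.tendsto_atTop]
    intro ε hε
    obtain ⟨k0, hk0⟩ := hosc (max R0 (N x)) (le_max_left _ _) f (ε / 2) (half_pos hε)
    refine ⟨k0, fun k hk => ?_⟩
    rw [Real.dist_eq, sub_zero]
    have := hk0 k hk x (Set.mem_ofPred_eq ▸ le_max_right R0 (N x)) 0
      (Set.mem_ofPred_eq ▸ hNz.trans (le_max_left R0 (N x)))
    linarith
  simpa using hd.add hc

/-- Theorem 4: large-scale interconnection of `M` ensembles.  The augmented matrix `𝒜` is
block lower triangular with diagonal blocks the block diagonal matrix of all Schur agent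
matrices `A q i`, the block diagonal matrix of the Schur filter matrices `Af q`, and the block
diagonal matrix of the Schur controller matrices `Ac q`; the affine maps `W ℓ ξ = 𝒜 ξ + β ℓ`
are chosen with Dini continuous probabilities bounded below by `δ > 0`.  Then the associated
Markov kernel has a unique invariant Borel probability measure, which is attractive. -/
theorem large_scale_interconnection_unique_attractive_invariant_measure
    {M : ℕ} {N : Fin M → ℕ} {n : ∀ q : Fin M, Fin (N q) → ℕ} {nf nc : Fin M → ℕ}
    (A : ∀ q : Fin M, ∀ i : Fin (N q), Matrix (Fin (n q i)) (Fin (n q i)) ℝ)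
    (Af : ∀ q : Fin M, Matrix (Fin (nf q)) (Fin (nf q)) ℝ)
    (Ac : ∀ q : Fin M, Matrix (Fin (nc q)) (Fin (nc q)) ℝ)
    (hA : ∀ q i, IsSchur (A q i)) (hAf : ∀ q, IsSchur (Af q)) (hAc : ∀ q, IsSchur (Ac q))
    (𝒜 : Matrix (IdxMS M N n nf nc) (IdxMS M N n nf nc) ℝ)
    (hlower : ∀ i j, blkMS i < blkMS j → 𝒜 i j = 0)
    (hD₁ : ∀ a b, 𝒜 (Sum.inl a) (Sum.inl b) =
      Matrix.blockDiagonal' (fun q => Matrix.blockDiagonal' (A q)) a b)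
    (hD₂ : ∀ a b, 𝒜 (Sum.inr (Sum.inl a)) (Sum.inr (Sum.inl b)) =
      Matrix.blockDiagonal' Af a b)
    (hD₃ : ∀ a b, 𝒜 (Sum.inr (Sum.inr a)) (Sum.inr (Sum.inr b)) =
      Matrix.blockDiagonal' Ac a b)
    {L : ℕ} (β : Fin L → EuclideanSpace ℝ (IdxMS M N n nf nc))
    (W : Fin L → EuclideanSpace ℝ (IdxMS M N n nf nc) →
      EuclideanSpace ℝ (IdxMS M N n nf nc))
    (hW : ∀ ℓ ξ, W ℓ ξ = Matrix.toEuclideanLin 𝒜 ξ + β ℓ)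
    (p : Fin L → EuclideanSpace ℝ (IdxMS M N n nf nc) → ℝ)
    (hp01 : ∀ ℓ x, p ℓ x ∈ Set.Icc (0 : ℝ) 1)
    (hpDini : ∀ ℓ, DiniContinuous (p ℓ))
    (hpsum : ∀ x, ∑ ℓ, p ℓ x = 1)
    (δ : ℝ) (hδ : 0 < δ) (hplb : ∀ ℓ x, δ ≤ p ℓ x) :
    ∃ μstar : Measure (EuclideanSpace ℝ (IdxMS M N n nf nc)),
      (IsProbabilityMeasure μstar ∧ Invariant (IFSKernel p W) μstar) ∧
      (∀ μ : Measure (EuclideanSpace ℝ (IdxMS M N n nf nc)),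
        IsProbabilityMeasure μ → Invariant (IFSKernel p W) μ → μ = μstar) ∧
      Attractive (IFSKernel p W) μstar := by
  have hS : IsSchur 𝒜 := by
    rw [isSchur_iff]
    refine Sch.lower 𝒜 (fun a b => hlower _ _ ?_) ?_ (Sch.lower _ (fun a b => hlower _ _ ?_) ?_ ?_)
    · rcases b with b | b <;> simp [blkMS]
    · have : (Matrix.of fun a b => 𝒜 (Sum.inl a) (Sum.inl b)) =
        Matrix.blockDiagonal' (fun q => Matrix.blockDiagonal' (A q)) := by ext a b; exact hD₁ a b
      rw [this]
      exact Sch.blockDiagonal' _ fun q => Sch.blockDiagonal' _ fun i => (isSchur_iff _).1 (hA q i)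
    · simp [blkMS]
    · have : (Matrix.of fun a b => 𝒜 (Sum.inr (Sum.inl a)) (Sum.inr (Sum.inl b))) =
        Matrix.blockDiagonal' Af := by ext a b; exact hD₂ a b
      change Sch (Matrix.of fun a b => 𝒜 (Sum.inr (Sum.inl a)) (Sum.inr (Sum.inl b)))
      rw [this]
      exact Sch.blockDiagonal' _ fun q => (isSchur_iff _).1 (hAf q)
    · have : (Matrix.of fun a b => 𝒜 (Sum.inr (Sum.inr a)) (Sum.inr (Sum.inr b))) =
        Matrix.blockDiagonal' Ac := by ext a b; exact hD₃ a b
      change Sch (Matrix.of fun a b => 𝒜 (Sum.inr (Sum.inr a)) (Sum.inr (Sum.inr b)))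
      rw [this]
      exact Sch.blockDiagonal' _ fun q => (isSchur_iff _).1 (hAc q)
  obtain ⟨s, hs, hs'⟩ := schur_summable 𝒜 hS
  obtain ⟨N', C, ρ, h1, h2, h3, h4, h5, h6, h7⟩ := exists_adapted _ s hs hs'
  exact affine_main (Matrix.toEuclideanLin 𝒜) h1 h2 h3 h4 h5 h6 h7 β W hW p
    (fun l x => (hp01 l x).1) hpsum hpDini δ hδ hplb
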